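/- There exist two trees T and T' on the same number n of vertices such that for every σ > 0 the graph distance measures satisfy d_{q₁}(T, T') < d_{λ₁}(T, T'), where d_I(G, H) = 1 − exp(−((I(G) − I(H))/σ)²). In particular, the conjectured inequality d_{q₁}(T, T') ≥ d_{λ₁}(T, T') for all trees T, T' on n vertices is false. -/

import Mathlib

open Classical in
/-- Adjacency matrix of a simple graph, with real entries. -/
noncomputable def adjMat {V : Type*} [Fintype V] (G : SimpleGraph V) : Matrix V V ℝ :=
  fun i j => if G.Adj i j then 1 else 0

/-- Degree of a vertex, as a real number (row sum of the adjacency matrix). -/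
noncomputable def degRe {V : Type*} [Fintype V] (G : SimpleGraph V) (v : V) : ℝ :=
  ∑ j, adjMat G v j

/-- Laplacian matrix `L(G) = D(G) - A(G)`. -/
noncomputable def lapMat {V : Type*} [Fintype V] [DecidableEq V] (G : SimpleGraph V) :
    Matrix V V ℝ :=
  Matrix.diagonal (degRe G) - adjMat G

/-- Largest eigenvalue of the adjacency matrix (which is real symmetric, so its spectrum is a
nonempty finite set of reals). -/
noncomputable def lam1 {V : Type*} [Fintype V] [DecidableEq V] (G : SimpleGraph V) : ℝ :=
  sSup (spectrum ℝ (adjMat G))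

/-- Largest eigenvalue of the Laplacian matrix. -/
noncomputable def q1 {V : Type*} [Fintype V] [DecidableEq V] (G : SimpleGraph V) : ℝ :=
  sSup (spectrum ℝ (lapMat G))

/-- Sum of squared vertex degrees (the second degree power / zeroth Randić index). -/
noncomputable def F2 {V : Type*} [Fintype V] (G : SimpleGraph V) : ℝ :=
  ∑ v, (degRe G v) ^ 2

/-- The graph distance measure `d_I(G,H) = 1 - exp(-((I(G)-I(H))/σ)^2)`, as a function of the
parameter `σ` and the two invariant values `x = I(G)` and `y = I(H)`. -/
noncomputable def dMeasure (σ x y : ℝ) : ℝ :=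
  1 - Real.exp (-(((x - y) / σ) ^ 2))

theorem abs_adjMat {V : Type*} [Fintype V] (G : SimpleGraph V) (i j : V) :
    |adjMat G i j| = adjMat G i j := by
  unfold adjMat
  split_ifs <;> simp

section SpectralBounds

variable {V : Type*} [Fintype V] [DecidableEq V]

/-- Collatz–Wielandt upper bound for real eigenvalues. -/
theorem le_of_mem_spectrum_of_sum_abs_mul_le {M : Matrix V V ℝ} {w : V → ℝ} {c : ℝ}
    (hw : ∀ i, 0 < w i) (h : ∀ i, ∑ j, |M i j| * w j ≤ c * w i) {μ : ℝ}
    (hμ : μ ∈ spectrum ℝ M) : μ ≤ c := by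
  rw [← Matrix.spectrum_toLin', ← Module.End.hasEigenvalue_iff_mem_spectrum] at hμ
  obtain ⟨v, hv⟩ := hμ.exists_hasEigenvector
  obtain ⟨i₀, hi₀⟩ := Function.ne_iff.1 hv.2
  have : Nonempty V := ⟨i₀⟩
  obtain ⟨i, hi⟩ := Finite.exists_max fun i => |v i| / w i
  have hpos : 0 < |v i| / w i := (div_pos (abs_pos.2 hi₀) (hw i₀)).trans_le (hi i₀)
  have hle (j : V) : |v j| ≤ |v i| / w i * w j := (div_le_iff₀ (hw j)).1 (hi j)
  have heq : ∑ j, M i j * v j = μ * v i := by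
    simpa [Matrix.mulVec, dotProduct] using congrFun hv.apply_eq_smul i
  have key : μ * |v i| ≤ c * |v i| :=
    calc
      μ * |v i| ≤ |μ * v i| := by
        rw [abs_mul]
        exact mul_le_mul_of_nonneg_right (le_abs_self μ) (abs_nonneg _)
      _ ≤ ∑ j, |M i j * v j| := heq ▸ Finset.abs_sum_le_sum_abs _ _
      _ ≤ ∑ j, |v i| / w i * (|M i j| * w j) := by
        refine Finset.sum_le_sum fun j _ => ?_
        rw [abs_mul, mul_left_comm]
        exact mul_le_mul_of_nonneg_left (hle j) (abs_nonneg _)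
      _ ≤ |v i| / w i * (c * w i) := by
        rw [← Finset.mul_sum]
        exact mul_le_mul_of_nonneg_left (h i) hpos.le
      _ = c * |v i| := by field_simp [(hw i).ne']
  have hvi : 0 < |v i| := by
    by_contra hcon
    rw [le_antisymm (not_lt.1 hcon) (abs_nonneg _), zero_div] at hpos
    exact lt_irrefl _ hpos
  exact le_of_mul_le_mul_right key hvi

theorem mem_spectrum_of_mulVec_eq {M : Matrix V V ℝ} {v : V → ℝ} {c : ℝ} (hv : v ≠ 0)
    (h : M.mulVec v = c • v) : c ∈ spectrum ℝ M := by
  rw [← Matrix.spectrum_toLin', ← Module.End.hasEigenvalue_iff_mem_spectrum]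
  exact Module.End.hasEigenvalue_of_hasEigenvector
    (Module.End.hasEigenvector_iff.2 ⟨Module.End.mem_eigenspace_iff.2 (by simpa using h), hv⟩)

/-- A positive weight `w` with `A w ≤ c w` bounds the largest adjacency eigenvalue by `c`. -/
theorem lam1_le {G : SimpleGraph V} {w : V → ℝ} {c : ℝ} (hc : 0 ≤ c) (hw : ∀ i, 0 < w i)
    (h : ∀ i, ∑ j, adjMat G i j * w j ≤ c * w i) : lam1 G ≤ c :=
  Real.sSup_le (fun _ hμ => le_of_mem_spectrum_of_sum_abs_mul_le hw
    (by simpa only [abs_adjMat] using h) hμ) hc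

theorem lam1_eq [Nonempty V] {G : SimpleGraph V} {w : V → ℝ} {c : ℝ} (hw : ∀ i, 0 < w i)
    (h : ∀ i, ∑ j, adjMat G i j * w j = c * w i) : lam1 G = c := by
  refine IsGreatest.csSup_eq ⟨mem_spectrum_of_mulVec_eq (v := w) ?_ (funext h), fun _ hμ =>
    le_of_mem_spectrum_of_sum_abs_mul_le hw (fun i => ?_) hμ⟩
  · exact Function.ne_iff.2 ⟨Classical.arbitrary V, (hw _).ne'⟩
  · simpa only [abs_adjMat] using (h i).le

/-- For a bipartite graph with sign function `ε`, a positive eigenvector of the signless Laplacian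
determines the largest Laplacian eigenvalue. -/
theorem q1_eq [Nonempty V] {G : SimpleGraph V} {ε w : V → ℝ} {c : ℝ} (hε₀ : ∀ i, ε i ≠ 0)
    (hε : ∀ i j, G.Adj i j → ε j = -ε i) (hw : ∀ i, 0 < w i)
    (h : ∀ i, degRe G i * w i + ∑ j, adjMat G i j * w j = c * w i) : q1 G = c := by
  have hdeg (i : V) : 0 ≤ degRe G i :=
    Finset.sum_nonneg fun j _ => abs_adjMat G i j ▸ abs_nonneg _
  refine IsGreatest.csSup_eq ⟨mem_spectrum_of_mulVec_eq (v := fun i => ε i * w i) ?_ ?_,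
    fun _ hμ => le_of_mem_spectrum_of_sum_abs_mul_le hw (fun i => ?_) hμ⟩
  · exact Function.ne_iff.2
      ⟨Classical.arbitrary V, mul_ne_zero (hε₀ _) (hw _).ne'⟩
  · funext i
    have hsum : ∑ j, adjMat G i j * (ε j * w j) = -(ε i * ∑ j, adjMat G i j * w j) := by
      rw [Finset.mul_sum, ← Finset.sum_neg_distrib]
      refine Finset.sum_congr rfl fun j _ => ?_
      by_cases hij : G.Adj i j
      · rw [hε i j hij]
        ring
      · simp [adjMat, hij]
    calc
      (lapMat G).mulVec (fun i => ε i * w i) i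
          = degRe G i * (ε i * w i) - ∑ j, adjMat G i j * (ε j * w j) := by
        rw [lapMat, Matrix.sub_mulVec, Pi.sub_apply, Matrix.mulVec_diagonal]
        rfl
      _ = c * (ε i * w i) := by
        rw [hsum]
        linear_combination ε i * h i
  · calc
      ∑ j, |lapMat G i j| * w j
          ≤ ∑ j, (Matrix.diagonal (degRe G) i j * w j + adjMat G i j * w j) := by
        refine Finset.sum_le_sum fun j _ => ?_
        rw [← add_mul]
        refine mul_le_mul_of_nonneg_right ((abs_sub _ _).trans ?_) (hw j).le
        rw [abs_adjMat]
        refine add_le_add_left (le_of_eq (abs_of_nonneg ?_)) _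
        rw [Matrix.diagonal_apply]
        split_ifs
        exacts [hdeg i, le_rfl]
      _ = degRe G i * w i + ∑ j, adjMat G i j * w j := by
        simp [Finset.sum_add_distrib, Matrix.diagonal_apply]
      _ ≤ c * w i := (h i).le

end SpectralBounds

/-- The graph on `Fin 8` joining every vertex to its parent. -/
def parentGraph (p : Fin 8 → Fin 8) : SimpleGraph (Fin 8) where
  Adj i j := i ≠ j ∧ (p i = j ∨ p j = i)
  symm := ⟨fun _ _ h => ⟨h.1.symm, h.2.symm⟩⟩
  loopless := ⟨fun _ h => h.1 rfl⟩

instance (p : Fin 8 → Fin 8) : DecidableRel (parentGraph p).Adj := fun i j =>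
  inferInstanceAs (Decidable (i ≠ j ∧ (p i = j ∨ p j = i)))

theorem parentGraph_connected {p : Fin 8 → Fin 8} (hp : ∀ i, i ≠ 0 → p i < i) :
    (parentGraph p).Connected := by
  have key (i : Fin 8) : (parentGraph p).Reachable i 0 := by
    induction i using WellFoundedLT.induction with
    | ind i ih =>
      by_cases hi : i = 0
      · rw [hi]
      · have hlt := hp i hi
        have hadj : (parentGraph p).Adj i (p i) := ⟨hlt.ne', Or.inl rfl⟩
        exact hadj.reachable.trans (ih _ hlt)
  exact { preconnected := fun i j => (key i).trans (key j).symm }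

/-- Two three-vertex stars whose centres are joined by a path with two inner vertices. -/
abbrev doubleBroom : SimpleGraph (Fin 8) := parentGraph ![0, 0, 0, 0, 1, 4, 5, 5]

/-- The spider with legs of lengths one, two and four. -/
abbrev spider : SimpleGraph (Fin 8) := parentGraph ![0, 0, 0, 0, 1, 2, 4, 6]

theorem doubleBroom_isTree : doubleBroom.IsTree := by
  rw [SimpleGraph.isTree_iff_connected_and_card]
  refine ⟨parentGraph_connected (by decide), ?_⟩
  rw [Nat.card_eq_fintype_card, Nat.card_eq_fintype_card, ← SimpleGraph.edgeFinset_card]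
  decide

theorem spider_isTree : spider.IsTree := by
  rw [SimpleGraph.isTree_iff_connected_and_card]
  refine ⟨parentGraph_connected (by decide), ?_⟩
  rw [Nat.card_eq_fintype_card, Nat.card_eq_fintype_card, ← SimpleGraph.edgeFinset_card]
  decide

theorem adjMat_parentGraph (p : Fin 8 → Fin 8) (i j : Fin 8) :
    adjMat (parentGraph p) i j = if i ≠ j ∧ (p i = j ∨ p j = i) then 1 else 0 := by
  unfold adjMat
  congr

theorem lam1_doubleBroom : lam1 doubleBroom = 2 := by
  refine lam1_eq (w := ![2, 2, 1, 1, 2, 2, 1, 1]) (fun i => ?_) (fun i => ?_) <;>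
    fin_cases i <;> simp [adjMat_parentGraph, Fin.sum_univ_eight] <;> norm_num

theorem lam1_spider_lt : lam1 spider < 2 := by
  refine (lam1_le (c := 253 / 127) (w := ![189, 154, 127, 95, 117, 64, 79, 40]) (by norm_num)
    (fun i => ?_) (fun i => ?_)).trans_lt (by norm_num) <;>
    fin_cases i <;> simp [adjMat_parentGraph, Fin.sum_univ_eight] <;> norm_num

theorem exists_laplacian_root : ∃ μ : ℝ, 4 ≤ μ ∧ μ ^ 3 - 7 * μ ^ 2 + 12 * μ - 2 = 0 := by
  have hcont : ContinuousOn (fun μ : ℝ => μ ^ 3 - 7 * μ ^ 2 + 12 * μ - 2) (Set.Icc 4 5) := by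
    fun_prop
  obtain ⟨μ, hμ, h⟩ := intermediate_value_Icc (by norm_num) hcont
    (show (0 : ℝ) ∈ _ by constructor <;> norm_num)
  exact ⟨μ, hμ.1, h⟩

theorem q1_doubleBroom {μ : ℝ} (hμ : 4 ≤ μ) (h : μ ^ 3 - 7 * μ ^ 2 + 12 * μ - 2 = 0) :
    q1 doubleBroom = μ := by
  refine q1_eq (ε := ![1, -1, -1, -1, 1, -1, 1, 1])
    (w := ![μ - 1, μ ^ 2 - 4 * μ + 1, 1, 1, μ ^ 2 - 4 * μ + 1, μ - 1, 1, 1]) (fun i => ?_) ?_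
    (fun i => ?_) (fun i => ?_)
  · fin_cases i <;> simp
  · intro i j hij
    fin_cases i <;> fin_cases j <;> first | (exact absurd hij (by decide)) | simp
  · fin_cases i <;> simp <;> nlinarith
  · fin_cases i <;> simp [degRe, adjMat_parentGraph, Fin.sum_univ_eight] <;>
      first | ring1 | linear_combination -h

theorem q1_spider {μ : ℝ} (hμ : 4 ≤ μ) (h : μ ^ 3 - 7 * μ ^ 2 + 12 * μ - 2 = 0) :
    q1 spider = μ := by
  refine q1_eq (ε := ![1, -1, -1, -1, 1, 1, -1, 1])
    (w := ![3 * μ ^ 2 - 8 * μ + 1, 2 * μ ^ 2 - 6 * μ + 1, (μ - 1) ^ 2, μ ^ 2 - 3 * μ + 1,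
      μ ^ 2 - 3 * μ + 1, μ - 1, μ - 1, 1]) (fun i => ?_) ?_ (fun i => ?_) (fun i => ?_)
  · fin_cases i <;> simp
  · intro i j hij
    fin_cases i <;> fin_cases j <;> first | (exact absurd hij (by decide)) | simp
  · fin_cases i <;> simp <;> nlinarith
  · fin_cases i <;> simp [degRe, adjMat_parentGraph, Fin.sum_univ_eight] <;>
      first | ring1 | linear_combination -h | linear_combination -2 * h |
        linear_combination -3 * h

theorem dMeasure_self_lt {σ x y z : ℝ} (hσ : 0 < σ) (hyz : y ≠ z) :
    dMeasure σ x x < dMeasure σ y z := by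
  have : 0 < ((y - z) / σ) ^ 2 := by
    have := div_ne_zero (sub_ne_zero.2 hyz) hσ.ne'
    positivity
  simpa [dMeasure] using this

/-- There exist two trees on the same number `n` of vertices with
`d_{q₁}(T,T') < d_{λ₁}(T,T')` for every `σ > 0`; in particular the conjectured inequality
`d_{q₁}(T,T') ≥ d_{λ₁}(T,T')` for all trees on `n` vertices is false. -/
theorem exists_trees_dq1_lt_dlam1 :
    (∃ (n : ℕ) (T T' : SimpleGraph (Fin n)), T.IsTree ∧ T'.IsTree ∧
      ∀ σ : ℝ, 0 < σ → dMeasure σ (q1 T) (q1 T') < dMeasure σ (lam1 T) (lam1 T')) ∧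
    ¬ (∀ (n : ℕ) (T T' : SimpleGraph (Fin n)), T.IsTree → T'.IsTree →
        ∀ σ : ℝ, 0 < σ → dMeasure σ (q1 T) (q1 T') ≥ dMeasure σ (lam1 T) (lam1 T')) := by
  have key (σ : ℝ) (hσ : 0 < σ) : dMeasure σ (q1 doubleBroom) (q1 spider) <
      dMeasure σ (lam1 doubleBroom) (lam1 spider) := by
    obtain ⟨μ, hμ, h⟩ := exists_laplacian_root
    rw [q1_doubleBroom hμ h, q1_spider hμ h, lam1_doubleBroom]
    exact dMeasure_self_lt hσ lam1_spider_lt.ne'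
  exact ⟨⟨8, doubleBroom, spider, doubleBroom_isTree, spider_isTree, key⟩, fun hall =>
    (key 1 one_pos).not_ge (hall 8 doubleBroom spider doubleBroom_isTree spider_isTree 1 one_pos)⟩
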